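/- There is a unique K-linear map ∂ : I_n → I_n that vanishes on k_n, takes the prescribed values on the generators c^p_{ij}, and satisfies the graded Leibniz rule ∂(ab) = ∂(a)b + (−1)^{|a|} a ∂(b) for homogeneous a. This map ∂ is homogeneous of degree +1 with respect to the grading |c^p_{ij}| = 1 − 2p + m_j − m_i, satisfies ∂ ∘ ∂ = 0 (so (I_n, ∂) is a differential graded algebra), and maps the subalgebra A_n into A_n (so A_n is a DG-subalgebra). -/

import Mathlib

/-!
Internal DG-algebra of Ekholm–Ng. Fix a field `K`, `n ≥ 1` and integers `m : Fin n → ℤ`.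
`IAlg K n` is the free associative `k_n`-algebra on generators `c^p_{ij}` (with
`c^0_{ij} = 0` for `i ≥ j`), realised as a quotient of the free `K`-algebra on the
generators together with the orthogonal idempotents `e i` spanning `k_n`.
-/

namespace InternalAlgebra

inductive IGen (n : ℕ) : Type
  | e (i : Fin n) : IGen n
  | c (p : ℕ) (i j : Fin n) : IGen n

open IGen

variable (K : Type) [Field K] (n : ℕ)

/-- Relations defining the free `k_n`-algebra on the generators `c^p_{ij}`:
the `e i` are orthogonal idempotents summing to `1`, each `c^p_{ij}` satisfies
`e j * c^p_{ij} = c^p_{ij} = c^p_{ij} * e i`, and `c^0_{ij} = 0` unless `i < j`. -/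
inductive Rel : FreeAlgebra K (IGen n) → FreeAlgebra K (IGen n) → Prop
  | idem (i : Fin n) :
      Rel (FreeAlgebra.ι K (e i) * FreeAlgebra.ι K (e i)) (FreeAlgebra.ι K (e i))
  | orth (i j : Fin n) (h : i ≠ j) :
      Rel (FreeAlgebra.ι K (e i) * FreeAlgebra.ι K (e j)) 0
  | total : Rel (∑ i : Fin n, FreeAlgebra.ι K (e i)) 1
  | left (p : ℕ) (i j : Fin n) :
      Rel (FreeAlgebra.ι K (e j) * FreeAlgebra.ι K (c p i j)) (FreeAlgebra.ι K (c p i j))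
  | right (p : ℕ) (i j : Fin n) :
      Rel (FreeAlgebra.ι K (c p i j) * FreeAlgebra.ι K (e i)) (FreeAlgebra.ι K (c p i j))
  | czero (i j : Fin n) (h : ¬ i < j) : Rel (FreeAlgebra.ι K (c 0 i j)) 0

/-- The internal algebra `I_n` (as a `K`-algebra; the `k_n`-structure is spanned by
the images of the idempotents `e i`). -/
abbrev IAlg := RingQuot (Rel K n)

/-- The image of a generator in `I_n`. -/
def ι (g : IGen n) : IAlg K n := RingQuot.mkAlgHom K (Rel K n) (FreeAlgebra.ι K g)

variable (m : Fin n → ℤ)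

/-- Degrees of the generators: `|e i| = 0`, `|c^p_{ij}| = 1 - 2p + m j - m i`. -/
def dg : IGen n → ℤ
  | e _ => 0
  | c p i j => 1 - 2 * (p : ℤ) + m j - m i

/-- The homogeneous component of degree `d`: the `K`-span of products of generators
whose degrees sum to `d`. -/
def Hgr (d : ℤ) : Submodule K (IAlg K n) :=
  Submodule.span K
    { x | ∃ l : List (IGen n), (l.map (dg n m)).sum = d ∧ x = (l.map (ι K n)).prod }

/-- `(-1)^d` as an element of `K`. -/
def sgn (d : ℤ) : K := if Even d then 1 else -1

/-- The prescribed values of the differential on the generators. -/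
def Dval : IGen n → IAlg K n
  | e _ => 0
  | c 0 i j =>
      ∑ r : Fin n,
        if i < r ∧ r < j then
          sgn K (m r + m j) • (ι K n (c 0 r j) * ι K n (c 0 i r)) else 0
  | c 1 i j =>
      (if i = j then ι K n (e i) else 0)
      + ∑ r : Fin n,
          ((if i < r then sgn K (m r + m j) • (ι K n (c 1 r j) * ι K n (c 0 i r)) else 0)
            + (if r < j then sgn K (m r + m j) • (ι K n (c 0 r j) * ι K n (c 1 i r)) else 0))
  | c (p + 2) i j =>
      ∑ q ∈ Finset.range (p + 3), ∑ r : Fin n,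
        sgn K (m r + m j) • (ι K n (c (p + 2 - q) r j) * ι K n (c q i r))

/-- The subalgebra `A_n` generated over `k_n` by the `c^0_{ij}` and `c^1_{ij}`. -/
def Asub : Subalgebra K (IAlg K n) :=
  Algebra.adjoin K
    ({x | ∃ i, x = ι K n (e i)} ∪ {x | ∃ i j, x = ι K n (c 0 i j)}
      ∪ {x | ∃ i j, x = ι K n (c 1 i j)})

/-- `D` vanishes on `k_n`, takes the prescribed values on the generators, and satisfies
the graded Leibniz rule. -/
def IsDiff (D : IAlg K n →ₗ[K] IAlg K n) : Prop :=
  (∀ i : Fin n, D (ι K n (e i)) = 0) ∧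
  (∀ (p : ℕ) (i j : Fin n), D (ι K n (c p i j)) = Dval K n m (c p i j)) ∧
  (∀ (d : ℤ) (a b : IAlg K n), a ∈ Hgr K n m d →
    D (a * b) = D a * b + sgn K d • (a * D b))

end InternalAlgebra

open InternalAlgebra

namespace InternalAlgebra

open IGen Finset

section Signs

variable (K : Type) [Field K]

lemma sgn_add (a b : ℤ) : sgn K (a + b) = sgn K a * sgn K b := by
  unfold sgn
  by_cases ha : Even a <;> by_cases hb : Even b <;> simp [Int.even_add, ha, hb]

lemma sgn_zero : sgn K 0 = 1 := by simp [sgn]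

lemma sgn_one : sgn K 1 = -1 := by simp [sgn]

lemma sgn_mul_self (a : ℤ) : sgn K a * sgn K a = 1 := by
  unfold sgn
  split_ifs <;> simp

lemma sgn_sub (a b : ℤ) : sgn K (a - b) = sgn K a * sgn K b := by
  unfold sgn
  by_cases ha : Even a <;> by_cases hb : Even b <;> simp [Int.even_sub, ha, hb]

lemma sgn_two_mul (a : ℤ) : sgn K (2 * a) = 1 := by simp [sgn]

end Signs

section Generators

variable (K : Type) [Field K] (n : ℕ)

lemma ι_rel {x y : FreeAlgebra K (IGen n)} (h : Rel K n x y) :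
    RingQuot.mkAlgHom K (Rel K n) x = RingQuot.mkAlgHom K (Rel K n) y :=
  RingQuot.mkAlgHom_rel K h

lemma ι_e_mul_self (i : Fin n) : ι K n (e i) * ι K n (e i) = ι K n (e i) := by
  simpa [ι] using ι_rel K n (Rel.idem i)

lemma ι_e_mul_e {i j : Fin n} (h : i ≠ j) : ι K n (e i) * ι K n (e j) = 0 := by
  simpa [ι] using ι_rel K n (Rel.orth i j h)

lemma sum_ι_e : ∑ i : Fin n, ι K n (e i) = 1 := by
  simpa [ι] using ι_rel K n Rel.total

lemma ι_e_mul_c (p : ℕ) (i j : Fin n) : ι K n (e j) * ι K n (c p i j) = ι K n (c p i j) := by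
  simpa [ι] using ι_rel K n (Rel.left p i j)

lemma ι_c_mul_e (p : ℕ) (i j : Fin n) : ι K n (c p i j) * ι K n (e i) = ι K n (c p i j) := by
  simpa [ι] using ι_rel K n (Rel.right p i j)

lemma ι_c_zero {i j : Fin n} (h : ¬ i < j) : ι K n (c 0 i j) = 0 := by
  simpa [ι] using ι_rel K n (Rel.czero i j h)

variable {K n} in
lemma IAlg.induction {P : IAlg K n → Prop} (algebraMap : ∀ r, P (algebraMap K (IAlg K n) r))
    (gen : ∀ g, P (ι K n g)) (mul : ∀ a b, P a → P b → P (a * b))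
    (add : ∀ a b, P a → P b → P (a + b)) (x : IAlg K n) : P x := by
  obtain ⟨y, rfl⟩ := RingQuot.mkAlgHom_surjective K (Rel K n) x
  induction y using FreeAlgebra.induction with
  | grade0 r => rw [AlgHom.commutes]; exact algebraMap r
  | grade1 g => exact gen g
  | mul a b ha hb => rw [map_mul]; exact mul _ _ ha hb
  | add a b ha hb => rw [map_add]; exact add _ _ ha hb

variable (m : Fin n → ℤ)

/-- The quadratic part of the differential of `c^p_{ij}`. -/
def quad (p : ℕ) (i j : Fin n) : IAlg K n :=
  ∑ x ∈ antidiagonal p, ∑ r : Fin n,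
    sgn K (m r + m j) • (ι K n (c x.1 r j) * ι K n (c x.2 i r))

/-- The part of the differential of `c^p_{ij}` lying in `k_n`. -/
def unitPart (p : ℕ) (i j : Fin n) : IAlg K n :=
  if p = 1 ∧ i = j then ι K n (e i) else 0

lemma Dval_c (p : ℕ) (i j : Fin n) :
    Dval K n m (c p i j) = unitPart K n p i j + quad K n m p i j := by
  match p with
  | 0 =>
    simp only [Dval, unitPart, quad, Nat.antidiagonal_zero, sum_singleton, zero_ne_one, false_and,
      if_false, zero_add]
    refine sum_congr rfl fun r _ ↦ ?_
    split_ifs with h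
    · rfl
    · rcases not_and_or.1 h with h | h <;> simp [ι_c_zero K n h]
  | 1 =>
    simp only [Dval, unitPart, quad, Nat.antidiagonal_succ, Nat.antidiagonal_zero, true_and, sum_cons,
      map_singleton, sum_singleton, sum_add_distrib]
    rw [add_comm (∑ r, _ : IAlg K n)]
    congr 1
    congr 1 <;>
    · refine sum_congr rfl fun r _ ↦ ?_
      split_ifs with h
      · rfl
      · simp [ι_c_zero K n h]
  | p + 2 =>
    simp only [Dval, unitPart, quad]
    rw [← Nat.sum_antidiagonal_swap, Nat.sum_antidiagonal_eq_sum_range_succ_mk]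
    simp

lemma e_mul_Dval_c (p : ℕ) (i j : Fin n) :
    ι K n (e j) * Dval K n m (c p i j) = Dval K n m (c p i j) := by
  simp only [Dval_c, unitPart, quad, mul_add, mul_sum, mul_smul_comm, ← mul_assoc, ι_e_mul_c]
  congr 1
  split_ifs with h
  · rw [h.2, ι_e_mul_self]
  · simp

lemma Dval_c_mul_e (p : ℕ) (i j : Fin n) :
    Dval K n m (c p i j) * ι K n (e i) = Dval K n m (c p i j) := by
  simp only [Dval_c, unitPart, quad, add_mul, sum_mul, smul_mul_assoc, mul_assoc, ι_c_mul_e]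
  congr 1
  split_ifs with h
  · rw [ι_e_mul_self]
  · simp

lemma Dval_c_zero {i j : Fin n} (h : ¬ i < j) : Dval K n m (c 0 i j) = 0 := by
  simp only [Dval]
  exact sum_eq_zero fun r _ ↦ if_neg fun hr ↦ h (hr.1.trans hr.2)

end Generators

section Grading

variable (K : Type) [Field K] (n : ℕ) (m : Fin n → ℤ)

lemma ι_mem_Hgr (g : IGen n) : ι K n g ∈ Hgr K n m (dg n m g) :=
  Submodule.subset_span ⟨[g], by simp, by simp⟩

variable {K n m} in
lemma mul_mem_Hgr {a b : IAlg K n} {s t : ℤ} (ha : a ∈ Hgr K n m s) (hb : b ∈ Hgr K n m t) :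
    a * b ∈ Hgr K n m (s + t) := by
  have := Submodule.mul_mem_mul ha hb
  rw [Hgr, Hgr, Submodule.span_mul_span] at this
  refine Submodule.span_mono ?_ this
  rintro _ ⟨_, ⟨l, hl, rfl⟩, _, ⟨l', hl', rfl⟩, rfl⟩
  exact ⟨l ++ l', by simp [hl, hl'], by simp⟩

lemma Dval_mem_Hgr (g : IGen n) : Dval K n m g ∈ Hgr K n m (dg n m g + 1) := by
  cases g with
  | e i => exact zero_mem _
  | c p i j =>
    rw [Dval_c]
    refine add_mem ?_ (sum_mem fun x hx ↦ sum_mem fun r _ ↦ Submodule.smul_mem _ _ ?_)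
    · unfold unitPart
      split_ifs with h
      · convert ι_mem_Hgr K n m (e i) using 1
        simp [dg, h.1, h.2]
      · exact zero_mem _
    · convert mul_mem_Hgr (ι_mem_Hgr K n m (c x.1 r j)) (ι_mem_Hgr K n m (c x.2 i r)) using 1
      simp only [dg, ← mem_antidiagonal.1 hx]
      push_cast
      congr 1
      ring

end Grading

section Differential

variable (K : Type) [Field K] (n : ℕ) (m : Fin n → ℤ)

/-- The matrix `[[σ g, ∂ g], [0, g]]` attached to a generator `g`, where `σ` is the parity
involution. -/
def genMatrix (g : IGen n) : Matrix (Fin 2) (Fin 2) (IAlg K n) :=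
  !![sgn K (dg n m g) • ι K n g, Dval K n m g; 0, ι K n g]

lemma lift_genMatrix_rel ⦃x y : FreeAlgebra K (IGen n)⦄ (h : Rel K n x y) :
    FreeAlgebra.lift K (genMatrix K n m) x = FreeAlgebra.lift K (genMatrix K n m) y := by
  induction h with
  | idem i =>
    simp [genMatrix, dg, sgn_zero, Dval, ι_e_mul_self]
  | orth i j h =>
    ext a b
    fin_cases a <;> fin_cases b <;>
      simp [genMatrix, dg, sgn_zero, Dval, ι_e_mul_e K n h]
  | total =>
    ext a b
    fin_cases a <;> fin_cases b <;>
      simp [genMatrix, Matrix.sum_apply, dg, sgn_zero, Dval, sum_ι_e]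
  | left p i j =>
    simp [genMatrix, sgn_zero, ι_e_mul_c, dg.eq_1, Dval.eq_1, e_mul_Dval_c]
  | right p i j =>
    simp [genMatrix, sgn_zero, ι_c_mul_e, dg.eq_1, Dval.eq_1, Dval_c_mul_e]
  | czero i j h =>
    ext a b
    fin_cases a <;> fin_cases b <;>
      simp [genMatrix, ι_c_zero K n h, Dval_c_zero K n m h]

/-- The algebra homomorphism `x ↦ [[σ x, ∂ x], [0, x]]`, where `σ` is the parity involution. -/
noncomputable def toMatrix : IAlg K n →ₐ[K] Matrix (Fin 2) (Fin 2) (IAlg K n) :=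
  RingQuot.liftAlgHom K ⟨FreeAlgebra.lift K (genMatrix K n m), lift_genMatrix_rel K n m⟩

lemma toMatrix_ι (g : IGen n) : toMatrix K n m (ι K n g) = genMatrix K n m g := by
  rw [toMatrix, ι, RingQuot.liftAlgHom_mkAlgHom_apply, FreeAlgebra.lift_ι_apply]

lemma toMatrix_lower (x : IAlg K n) : toMatrix K n m x 1 0 = 0 ∧ toMatrix K n m x 1 1 = x := by
  induction x using IAlg.induction with
  | algebraMap r => simp [AlgHom.commutes, Matrix.algebraMap_matrix_apply]
  | gen g => simp [toMatrix_ι, genMatrix]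
  | mul a b ha hb => simp [Matrix.mul_apply, ha, hb]
  | add a b ha hb => simp [ha, hb]

/-- The parity involution, `a ↦ (-1)^|a| a` on homogeneous elements. -/
noncomputable def parity : IAlg K n →ₗ[K] IAlg K n :=
  Matrix.entryLinearMap K (IAlg K n) 0 0 ∘ₗ (toMatrix K n m).toLinearMap

/-- The differential of the internal algebra. -/
noncomputable def diff : IAlg K n →ₗ[K] IAlg K n :=
  Matrix.entryLinearMap K (IAlg K n) 0 1 ∘ₗ (toMatrix K n m).toLinearMap

lemma parity_apply (x : IAlg K n) : parity K n m x = toMatrix K n m x 0 0 := rfl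

lemma diff_apply (x : IAlg K n) : diff K n m x = toMatrix K n m x 0 1 := rfl

lemma parity_ι (g : IGen n) : parity K n m (ι K n g) = sgn K (dg n m g) • ι K n g := by
  simp [parity_apply, toMatrix_ι, genMatrix]

lemma diff_ι (g : IGen n) : diff K n m (ι K n g) = Dval K n m g := by
  simp [diff_apply, toMatrix_ι, genMatrix]

lemma parity_algebraMap (r : K) :
    parity K n m (algebraMap K _ r) = algebraMap K (IAlg K n) r := by
  simp [parity_apply, AlgHom.commutes, Matrix.algebraMap_matrix_apply]

lemma diff_algebraMap (r : K) : diff K n m (algebraMap K (IAlg K n) r) = 0 := by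
  simp [diff_apply, AlgHom.commutes, Matrix.algebraMap_matrix_apply]

lemma parity_mul (a b : IAlg K n) : parity K n m (a * b) = parity K n m a * parity K n m b := by
  simp [parity_apply, Matrix.mul_apply, toMatrix_lower]

lemma diff_mul (a b : IAlg K n) :
    diff K n m (a * b) = diff K n m a * b + parity K n m a * diff K n m b := by
  simp [parity_apply, diff_apply, Matrix.mul_apply, toMatrix_lower, add_comm]

variable {K n m} in
lemma parity_of_mem_Hgr {d : ℤ} {a : IAlg K n} (ha : a ∈ Hgr K n m d) :
    parity K n m a = sgn K d • a := by
  induction ha using Submodule.span_induction with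
  | mem x hx =>
    obtain ⟨l, rfl, rfl⟩ := hx
    induction l with
    | nil => simpa [sgn_zero] using parity_algebraMap K n m 1
    | cons g l ih =>
      rw [List.map_cons, List.map_cons, List.prod_cons, List.sum_cons, parity_mul, parity_ι, ih,
        smul_mul_smul_comm, sgn_add]
  | zero => simp
  | add x y _ _ hx hy => simp [hx, hy]
  | smul r x _ hx => rw [map_smul, hx, smul_comm]

lemma isDiff_diff : IsDiff K n m (diff K n m) := by
  refine ⟨fun i ↦ diff_ι K n m (e i), fun p i j ↦ diff_ι K n m _, fun d a b ha ↦ ?_⟩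
  rw [diff_mul, parity_of_mem_Hgr ha, smul_mul_assoc]

variable {K n m} in
lemma IsDiff.eq {D D' : IAlg K n →ₗ[K] IAlg K n} (h : IsDiff K n m D) (h' : IsDiff K n m D') :
    D = D' := by
  have hgen (g : IGen n) : D (ι K n g) = D' (ι K n g) := by
    cases g with
    | e i => rw [h.1, h'.1]
    | c p i j => rw [h.2.1, h'.2.1]
  have key (x : IAlg K n) : ∀ y, D y = D' y → D (x * y) = D' (x * y) := by
    induction x using IAlg.induction with
    | algebraMap r => intro y hy; simp [← Algebra.smul_def, hy]
    | gen g =>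
      intro y hy
      rw [h.2.2 _ _ _ (ι_mem_Hgr K n m g), h'.2.2 _ _ _ (ι_mem_Hgr K n m g), hgen, hy]
    | mul a b ha hb => intro y hy; simpa [mul_assoc] using ha _ (hb _ hy)
    | add a b ha hb => intro y hy; simp [add_mul, ha y hy, hb y hy]
  have hone : D 1 = D' 1 := by
    simp only [← sum_ι_e, map_sum, hgen]
  ext x
  simpa using key x 1 hone

variable {K n m} in
lemma diff_mem_Hgr {d : ℤ} {a : IAlg K n} (ha : a ∈ Hgr K n m d) :
    diff K n m a ∈ Hgr K n m (d + 1) := by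
  induction ha using Submodule.span_induction with
  | mem x hx =>
    obtain ⟨l, rfl, rfl⟩ := hx
    induction l with
    | nil => simpa using (diff_algebraMap K n m 1).symm ▸ zero_mem (Hgr K n m 1)
    | cons g l ih =>
      rw [List.map_cons, List.map_cons, List.prod_cons, List.sum_cons, diff_mul, diff_ι, parity_ι,
        smul_mul_assoc]
      refine add_mem ?_ (Submodule.smul_mem _ _ ?_)
      · rw [add_right_comm]
        exact mul_mem_Hgr (Dval_mem_Hgr K n m g) (Submodule.subset_span ⟨l, rfl, rfl⟩)
      · rw [add_assoc]
        exact mul_mem_Hgr (ι_mem_Hgr K n m g) ih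
  | zero => simp
  | add x y _ _ hx hy => simpa using add_mem hx hy
  | smul r x _ hx => simpa using Submodule.smul_mem _ r hx

lemma parity_diff (x : IAlg K n) :
    parity K n m (diff K n m x) = (-1 : K) • diff K n m (parity K n m x) := by
  induction x using IAlg.induction with
  | algebraMap r => simp only [parity_algebraMap, diff_algebraMap, map_zero, smul_zero]
  | gen g =>
    rw [diff_ι, parity_ι, map_smul, diff_ι, parity_of_mem_Hgr (Dval_mem_Hgr K n m g), sgn_add,
      sgn_one, mul_comm, mul_smul]
  | mul a b ha hb =>
    simp only [parity_mul, diff_mul, map_add, ha, hb, smul_add, smul_mul_assoc, mul_smul_comm]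
  | add a b ha hb => simp only [map_add, ha, hb, smul_add]

lemma add_neg_one_smul (x : IAlg K n) : x + (-1 : K) • x = 0 := by
  simpa only [one_smul, add_neg_cancel, zero_smul] using (add_smul (1 : K) (-1) x).symm

lemma quad_mul_sum_eq (p : ℕ) (i j : Fin n) :
    ∑ x ∈ antidiagonal p, ∑ r : Fin n,
        sgn K (m r + m j) • (quad K n m x.1 r j * ι K n (c x.2 i r)) =
      ∑ x ∈ antidiagonal p, ∑ r : Fin n, ι K n (c x.1 r j) * quad K n m x.2 i r := by
  simp only [quad, sum_mul, mul_sum, smul_sum, smul_mul_assoc, mul_smul_comm, smul_smul]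
  simp_rw [sum_comm (s := univ) (t := antidiagonal _)]
  rw [sum_sigma', eq_comm, sum_sigma', eq_comm]
  refine sum_nbij' (fun x ↦ ⟨(x.2.1, x.2.2 + x.1.2), (x.2.2, x.1.2)⟩)
    (fun x ↦ ⟨(x.1.1 + x.2.1, x.2.2), (x.1.1, x.2.1)⟩) ?_ ?_ ?_ ?_ ?_
  · rintro ⟨⟨a, b⟩, ⟨s, t⟩⟩ h
    simp only [mem_sigma, HasAntidiagonal.mem_antidiagonal] at h ⊢
    exact ⟨by omega, trivial⟩
  · rintro ⟨⟨a, b⟩, ⟨s, t⟩⟩ h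
    simp only [mem_sigma, HasAntidiagonal.mem_antidiagonal] at h ⊢
    exact ⟨by omega, trivial⟩
  · rintro ⟨⟨a, b⟩, ⟨s, t⟩⟩ h
    simp only [mem_sigma, HasAntidiagonal.mem_antidiagonal] at h ⊢
    simp [h.2]
  · rintro ⟨⟨a, b⟩, ⟨s, t⟩⟩ h
    simp only [mem_sigma, HasAntidiagonal.mem_antidiagonal] at h ⊢
    simp [h.2]
  · rintro ⟨⟨a, b⟩, ⟨s, t⟩⟩ h
    rw [sum_comm]
    refine sum_congr rfl fun r _ ↦ sum_congr rfl fun t _ ↦ ?_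
    have : sgn K (m t + m j) * sgn K (m r + m j) = sgn K (m t + m r) := by
      simp only [sgn_add]
      linear_combination sgn K (m t) * sgn K (m r) * sgn_mul_self K (m j)
    rw [this, mul_assoc]

lemma unitPart_mul_sum_eq (p : ℕ) (i j : Fin n) :
    ∑ x ∈ antidiagonal p, ∑ r : Fin n,
        sgn K (m r + m j) • (unitPart K n x.1 r j * ι K n (c x.2 i r)) =
      ∑ x ∈ antidiagonal p, ∑ r : Fin n, ι K n (c x.1 r j) * unitPart K n x.2 i r := by
  rw [← Nat.sum_antidiagonal_swap]
  refine sum_congr rfl fun x _ ↦ ?_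
  by_cases h : x.2 = 1
  · simp [unitPart, h, ι_e_mul_c, ι_c_mul_e, ite_mul, mul_ite, sgn_add, sgn_mul_self]
  · simp [unitPart, h]

lemma diff_Dval (g : IGen n) : diff K n m (Dval K n m g) = 0 := by
  cases g with
  | e i => simp [Dval]
  | c p i j =>
    have hunit : diff K n m (unitPart K n p i j) = 0 := by
      unfold unitPart
      split_ifs
      · exact diff_ι K n m (e i)
      · exact map_zero _
    have hsgn (p : ℕ) (r : Fin n) :
        sgn K (m r + m j) * sgn K (dg n m (c p r j)) = -1 := by
      simp only [dg, sgn_add, sgn_sub, sgn_one, sgn_two_mul]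
      linear_combination (-sgn K (m r) * sgn K (m r)) * sgn_mul_self K (m j) - sgn_mul_self K (m r)
    rw [Dval_c, map_add, hunit, zero_add, quad]
    simp only [map_sum, map_smul, diff_mul, diff_ι, parity_ι, Dval_c, smul_add, smul_mul_assoc,
      smul_smul, hsgn, add_mul, mul_add, sum_add_distrib, unitPart_mul_sum_eq, quad_mul_sum_eq,
      ← smul_sum]
    rw [← smul_add, add_neg_one_smul]

lemma diff_diff (x : IAlg K n) : diff K n m (diff K n m x) = 0 := by
  induction x using IAlg.induction with
  | algebraMap r => simp [diff_algebraMap]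
  | gen g => rw [diff_ι, diff_Dval]
  | mul a b ha hb =>
    simp only [diff_mul, parity_diff, ha, hb, map_add, zero_mul, mul_zero, zero_add, add_zero,
      smul_mul_assoc]
    rw [add_comm, add_neg_one_smul]
  | add a b ha hb => simp [ha, hb]

lemma ι_e_mem_Asub (i : Fin n) : ι K n (e i) ∈ Asub K n :=
  Algebra.subset_adjoin (.inl (.inl ⟨i, rfl⟩))

lemma ι_c_mem_Asub {p : ℕ} (hp : p ≤ 1) (i j : Fin n) : ι K n (c p i j) ∈ Asub K n := by
  interval_cases p
  · exact Algebra.subset_adjoin (.inl (.inr ⟨i, j, rfl⟩))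
  · exact Algebra.subset_adjoin (.inr ⟨i, j, rfl⟩)

lemma Dval_c_mem_Asub {p : ℕ} (hp : p ≤ 1) (i j : Fin n) : Dval K n m (c p i j) ∈ Asub K n := by
  rw [Dval_c]
  refine add_mem ?_ (sum_mem fun x hx ↦ sum_mem fun r _ ↦
    Subalgebra.smul_mem _ (mul_mem (ι_c_mem_Asub K n ?_ r j) (ι_c_mem_Asub K n ?_ i r)) _)
  · unfold unitPart
    split_ifs
    · exact ι_e_mem_Asub K n i
    · exact zero_mem _
  · exact (Nat.le.intro (mem_antidiagonal.1 hx)).trans hp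
  · exact (Nat.le.intro ((add_comm _ _).trans (mem_antidiagonal.1 hx))).trans hp

variable {K n} in
lemma parity_diff_mem_Asub {x : IAlg K n} (hx : x ∈ Asub K n) :
    parity K n m x ∈ Asub K n ∧ diff K n m x ∈ Asub K n := by
  induction hx using Algebra.adjoin_induction with
  | mem x hx =>
    obtain (⟨i, rfl⟩ | ⟨i, j, rfl⟩) | ⟨i, j, rfl⟩ := hx <;> rw [parity_ι, diff_ι]
    · exact ⟨Subalgebra.smul_mem _ (ι_e_mem_Asub K n i) _, zero_mem _⟩
    · exact ⟨Subalgebra.smul_mem _ (ι_c_mem_Asub K n zero_le_one i j) _,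
        Dval_c_mem_Asub K n m zero_le_one i j⟩
    · exact ⟨Subalgebra.smul_mem _ (ι_c_mem_Asub K n le_rfl i j) _,
        Dval_c_mem_Asub K n m le_rfl i j⟩
  | algebraMap r =>
    rw [parity_algebraMap, diff_algebraMap]
    exact ⟨Subalgebra.algebraMap_mem _ r, zero_mem _⟩
  | add x y _ _ hx hy =>
    rw [map_add, map_add]
    exact ⟨add_mem hx.1 hy.1, add_mem hx.2 hy.2⟩
  | mul x y hxA hyA hx hy =>
    rw [parity_mul, diff_mul]
    exact ⟨mul_mem hx.1 hy.1, add_mem (mul_mem hx.2 hyA) (mul_mem hx.1 hy.2)⟩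

end Differential

end InternalAlgebra

/-- There is a unique `K`-linear map `∂ : I_n → I_n` vanishing on `k_n`,
taking the prescribed values on the generators `c^p_{ij}`, and satisfying the graded
Leibniz rule.  It is homogeneous of degree `+1`, squares to zero (so `(I_n, ∂)` is a
DG-algebra), and maps the subalgebra `A_n` into itself. -/
theorem statement0 (K : Type) [Field K] (n : ℕ) (hn : 1 ≤ n) (m : Fin n → ℤ) :
    ∃ D : IAlg K n →ₗ[K] IAlg K n,
      IsDiff K n m D ∧
      (∀ D' : IAlg K n →ₗ[K] IAlg K n, IsDiff K n m D' → D' = D) ∧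
      (∀ (d : ℤ) (a : IAlg K n), a ∈ Hgr K n m d → D a ∈ Hgr K n m (d + 1)) ∧
      (∀ x : IAlg K n, D (D x) = 0) ∧
      (∀ x : IAlg K n, x ∈ Asub K n → D x ∈ Asub K n) := by
  exact ⟨diff K n m, isDiff_diff K n m, fun D' hD' ↦ hD'.eq (isDiff_diff K n m),
    fun d a ha ↦ diff_mem_Hgr ha, diff_diff K n m, fun x hx ↦ (parity_diff_mem_Asub m hx).2⟩
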